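/- Let L(ψ)^i = g^{ij} ∂_x ψ_j + Γ^{ij}_k u^k_x ψ_j be a first-order operator acting on covectors ψ along a smooth map u : ℝ → ℝⁿ. Then L is formally skew-adjoint (∫ L(ψ¹)_i ψ²_i dx = −∫ ψ¹_i L(ψ²)_i dx for compactly supported arguments) if and only if g^{ij} = g^{ji} and ∂g^{ij}/∂u^k = Γ^{ij}_k + Γ^{ji}_k. -/

import Mathlib

open Finset MeasureTheory

/-- The pointwise defect. -/
theorem hyd_key (n : ℕ)
    (g : Fin n → Fin n → (Fin n → ℝ) → ℝ)
    (Γup : Fin n → Fin n → Fin n → (Fin n → ℝ) → ℝ)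
    (hg : ∀ i j, ContDiff ℝ (⊤ : ℕ∞) (g i j))
    (hΓ : ∀ i j k, ContDiff ℝ (⊤ : ℕ∞) (Γup i j k))
    (u : ℝ → Fin n → ℝ) (hu : ContDiff ℝ (⊤ : ℕ∞) u)
    (ψ₁ ψ₂ : ℝ → Fin n → ℝ) (h₁ : ContDiff ℝ (⊤ : ℕ∞) ψ₁) (h₂ : ContDiff ℝ (⊤ : ℕ∞) ψ₂)
    (c₁ : HasCompactSupport ψ₁) (c₂ : HasCompactSupport ψ₂) :
    ((∫ x : ℝ, ∑ i,
            (∑ j, g i j (u x) * deriv (fun t => ψ₁ t j) x +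
             ∑ j, ∑ k, Γup i j k (u x) * deriv (fun t => u t k) x * ψ₁ x j) * ψ₂ x i) =
        -∫ x : ℝ, ∑ i, ψ₁ x i *
            (∑ j, g i j (u x) * deriv (fun t => ψ₂ t j) x +
             ∑ j, ∑ k, Γup i j k (u x) * deriv (fun t => u t k) x * ψ₂ x j)) ↔
    (∫ x : ℝ, ∑ i, ∑ j,
      ((∑ k, (Γup i j k (u x) + Γup j i k (u x) - fderiv ℝ (g i j) (u x) (Pi.single k 1))
          * deriv (fun t => u t k) x) * ψ₁ x j * ψ₂ x i
        + (g j i (u x) - g i j (u x)) * ψ₁ x j * deriv (fun t => ψ₂ t i) x)) = 0 := by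
  have du : ∀ k x, HasDerivAt (fun t => u t k) (deriv (fun t => u t k) x) x := fun k x =>
    ((contDiff_pi.1 hu k).differentiable (by simp) x).hasDerivAt
  have d1 : ∀ k x, HasDerivAt (fun t => ψ₁ t k) (deriv (fun t => ψ₁ t k) x) x := fun k x =>
    ((contDiff_pi.1 h₁ k).differentiable (by simp) x).hasDerivAt
  have d2 : ∀ k x, HasDerivAt (fun t => ψ₂ t k) (deriv (fun t => ψ₂ t k) x) x := fun k x =>
    ((contDiff_pi.1 h₂ k).differentiable (by simp) x).hasDerivAt
  have cdu : ∀ k, Continuous (deriv (fun t => u t k)) := fun k =>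
    (contDiff_pi.1 hu k).continuous_deriv (by simp)
  have cd1 : ∀ k, Continuous (deriv (fun t => ψ₁ t k)) := fun k =>
    (contDiff_pi.1 h₁ k).continuous_deriv (by simp)
  have cd2 : ∀ k, Continuous (deriv (fun t => ψ₂ t k)) := fun k =>
    (contDiff_pi.1 h₂ k).continuous_deriv (by simp)
  have k1 : ∀ k, Continuous fun t => ψ₁ t k := fun k => (contDiff_pi.1 h₁ k).continuous
  have k2 : ∀ k, Continuous fun t => ψ₂ t k := fun k => (contDiff_pi.1 h₂ k).continuous
  have cu : Continuous u := hu.continuous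
  have cg : ∀ i j, Continuous fun x => g i j (u x) := fun i j => (hg i j).continuous.comp cu
  have cΓ : ∀ i j k, Continuous fun x => Γup i j k (u x) :=
    fun i j k => (hΓ i j k).continuous.comp cu
  have cfg : ∀ i j k, Continuous fun x => fderiv ℝ (g i j) (u x) (Pi.single k 1) := fun i j k =>
    (((hg i j).continuous_fderiv (by simp)).comp cu).clm_apply continuous_const
  have z1 : ∀ x, x ∉ tsupport ψ₁ → ∀ k, ψ₁ x k = 0 := fun x hx k => by
    rw [image_eq_zero_of_notMem_tsupport hx]; rfl
  have z2 : ∀ x, x ∉ tsupport ψ₂ → ∀ k, ψ₂ x k = 0 := fun x hx k => by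
    rw [image_eq_zero_of_notMem_tsupport hx]; rfl
  have hdg : ∀ i j x, HasDerivAt (fun t => g i j (u t))
      (∑ k, fderiv ℝ (g i j) (u x) (Pi.single k 1) * deriv (fun t => u t k) x) x := by
    intro i j x
    have a : HasFDerivAt (g i j) (fderiv ℝ (g i j) (u x)) (u x) :=
      ((hg i j).differentiable (by simp) _).hasFDerivAt
    have b : HasDerivAt u (fun k => deriv (fun t => u t k) x) x :=
      hasDerivAt_pi.2 fun k => du k x
    have c := a.comp_hasDerivAt x b
    refine HasDerivAt.congr_deriv c ?_
    have e := congrArg (fderiv ℝ (g i j) (u x))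
      (pi_eq_sum_univ (fun k => deriv (fun t => u t k) x))
    rw [map_sum] at e
    refine Eq.trans e ?_
    refine Finset.sum_congr rfl fun k _ => ?_
    rw [map_smul, smul_eq_mul, mul_comm]
    congr 2
    ext l
    simp [Pi.single_apply, eq_comm]
  set A : ℝ → ℝ := fun x => ∑ i,
            (∑ j, g i j (u x) * deriv (fun t => ψ₁ t j) x +
             ∑ j, ∑ k, Γup i j k (u x) * deriv (fun t => u t k) x * ψ₁ x j) * ψ₂ x i with hA
  set B : ℝ → ℝ := fun x => ∑ i, ψ₁ x i *
            (∑ j, g i j (u x) * deriv (fun t => ψ₂ t j) x +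
             ∑ j, ∑ k, Γup i j k (u x) * deriv (fun t => u t k) x * ψ₂ x j) with hB
  set D : ℝ → ℝ := fun x => ∑ i, ∑ j,
      ((∑ k, (Γup i j k (u x) + Γup j i k (u x) - fderiv ℝ (g i j) (u x) (Pi.single k 1))
          * deriv (fun t => u t k) x) * ψ₁ x j * ψ₂ x i
        + (g j i (u x) - g i j (u x)) * ψ₁ x j * deriv (fun t => ψ₂ t i) x) with hD
  set F : ℝ → ℝ := fun x => ∑ i, ∑ j, g i j (u x) * ψ₁ x j * ψ₂ x i with hF
  have iA : Integrable A := by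
    refine Continuous.integrable_of_hasCompactSupport (by fun_prop)
      (HasCompactSupport.intro c₂ fun x hx => ?_)
    simp [hA, z2 x hx]
  have iB : Integrable B := by
    refine Continuous.integrable_of_hasCompactSupport (by fun_prop)
      (HasCompactSupport.intro c₁ fun x hx => ?_)
    simp [hB, z1 x hx]
  have iD : Integrable D := by
    refine Continuous.integrable_of_hasCompactSupport (by fun_prop)
      (HasCompactSupport.intro c₁ fun x hx => ?_)
    simp [hD, z1 x hx]
  have cF : HasCompactSupport F := by
    refine HasCompactSupport.intro c₁ fun x hx => ?_
    simp [hF, z1 x hx]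
  have iF : Integrable F := Continuous.integrable_of_hasCompactSupport (by fun_prop) cF
  have hF' : ∀ x, HasDerivAt F (A x + B x - D x) x := by
    intro x
    have h : HasDerivAt F (∑ i, ∑ j,
        (((∑ k, fderiv ℝ (g i j) (u x) (Pi.single k 1) * deriv (fun t => u t k) x) * ψ₁ x j
          + g i j (u x) * deriv (fun t => ψ₁ t j) x) * ψ₂ x i
          + g i j (u x) * ψ₁ x j * deriv (fun t => ψ₂ t i) x)) x :=
      HasDerivAt.fun_sum fun i _ => HasDerivAt.fun_sum fun j _ =>
        ((hdg i j x).mul (d1 j x)).mul (d2 i x)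
    convert h using 1
    have hB2 : B x = ∑ i, ∑ j, ψ₁ x j * (g j i (u x) * deriv (fun t => ψ₂ t i) x +
        ∑ k, Γup j i k (u x) * deriv (fun t => u t k) x * ψ₂ x i) := by
      rw [Finset.sum_comm]
      refine Finset.sum_congr rfl fun i _ => ?_
      rw [← Finset.sum_add_distrib, Finset.mul_sum]
    have hA2 : A x = ∑ i, ∑ j, (g i j (u x) * deriv (fun t => ψ₁ t j) x +
        ∑ k, Γup i j k (u x) * deriv (fun t => u t k) x * ψ₁ x j) * ψ₂ x i := by
      refine Finset.sum_congr rfl fun i _ => ?_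
      rw [← Finset.sum_add_distrib, Finset.sum_mul]
    rw [hA2, hB2, ← Finset.sum_add_distrib, hD, ← Finset.sum_sub_distrib]
    refine Finset.sum_congr rfl fun i _ => ?_
    rw [← Finset.sum_add_distrib, ← Finset.sum_sub_distrib]
    refine Finset.sum_congr rfl fun j _ => ?_
    simp only [add_mul, sub_mul, Finset.sum_add_distrib, Finset.sum_sub_distrib, ← Finset.sum_mul]
    ring
  have h0 : ∫ x, (A x + B x - D x) = 0 :=
    integral_eq_zero_of_hasDerivAt_of_integrable hF' ((iA.add iB).sub iD) iF
  have h4 : ∫ x, (A x + B x - D x) = (∫ x, A x) + (∫ x, B x) - ∫ x, D x := by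
    have e1 := integral_sub (iA.add iB) iD
    have e2 := integral_add iA iB
    simp only [Pi.add_apply] at e1
    rw [e1, e2]
  constructor <;> intro h <;> linarith

/-- The first-order operator `L(ψ)^i = g^{ij} ∂_x ψ_j + Γ^{ij}_k u^k_x ψ_j` is
formally skew-adjoint for all smooth `u` and all smooth compactly supported
covectors if and only if `g^{ij} = g^{ji}` and `∂g^{ij}/∂u^k = Γ^{ij}_k + Γ^{ji}_k`. -/
theorem hydrodynamic_skew_adjoint_iff (n : ℕ)
    (g : Fin n → Fin n → (Fin n → ℝ) → ℝ)
    (Γup : Fin n → Fin n → Fin n → (Fin n → ℝ) → ℝ)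
    (hg : ∀ i j, ContDiff ℝ (⊤ : ℕ∞) (g i j))
    (hΓ : ∀ i j k, ContDiff ℝ (⊤ : ℕ∞) (Γup i j k)) :
    (∀ u : ℝ → Fin n → ℝ, ContDiff ℝ (⊤ : ℕ∞) u →
      ∀ ψ₁ ψ₂ : ℝ → Fin n → ℝ, ContDiff ℝ (⊤ : ℕ∞) ψ₁ → ContDiff ℝ (⊤ : ℕ∞) ψ₂ →
        HasCompactSupport ψ₁ → HasCompactSupport ψ₂ →
        (∫ x : ℝ, ∑ i,
            (∑ j, g i j (u x) * deriv (fun t => ψ₁ t j) x +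
             ∑ j, ∑ k, Γup i j k (u x) * deriv (fun t => u t k) x * ψ₁ x j) * ψ₂ x i) =
        -∫ x : ℝ, ∑ i, ψ₁ x i *
            (∑ j, g i j (u x) * deriv (fun t => ψ₂ t j) x +
             ∑ j, ∑ k, Γup i j k (u x) * deriv (fun t => u t k) x * ψ₂ x j)) ↔
    ((∀ i j v, g i j v = g j i v) ∧
     (∀ i j k (v : Fin n → ℝ),
        fderiv ℝ (g i j) v (Pi.single k 1) = Γup i j k v + Γup j i k v)) := by
  have hx := fun u hu ψ₁ ψ₂ h₁ h₂ c₁ c₂ => hyd_key n g Γup hg hΓ u hu ψ₁ ψ₂ h₁ h₂ c₁ c₂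
  constructor
  · intro H
    have key : ∀ u : ℝ → Fin n → ℝ, ContDiff ℝ (⊤ : ℕ∞) u → ∀ φ χ : ℝ → ℝ,
        ContDiff ℝ (⊤ : ℕ∞) φ → ContDiff ℝ (⊤ : ℕ∞) χ → HasCompactSupport φ →
        HasCompactSupport χ → ∀ i j,
        ∫ x : ℝ, ((∑ k, (Γup i j k (u x) + Γup j i k (u x)
            - fderiv ℝ (g i j) (u x) (Pi.single k 1))
          * deriv (fun t => u t k) x) * φ x * χ x
        + (g j i (u x) - g i j (u x)) * φ x * deriv χ x) = 0 := by
      intro u hu φ χ hφ hχ cφ cχ i j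
      have sm : ∀ (f : ℝ → ℝ) (a : Fin n), ContDiff ℝ (⊤ : ℕ∞) f →
          ContDiff ℝ (⊤ : ℕ∞) (fun x => (Pi.single a (f x) : Fin n → ℝ)) := by
        intro f a hf
        refine contDiff_pi.2 fun b => ?_
        by_cases hb : b = a
        · subst hb; simpa using hf
        · simpa [Pi.single_apply, hb] using contDiff_const
      have cs : ∀ (f : ℝ → ℝ) (a : Fin n), HasCompactSupport f →
          HasCompactSupport (fun x => (Pi.single a (f x) : Fin n → ℝ)) := by
        intro f a hf
        exact hf.comp_left (g := fun y => (Pi.single a y : Fin n → ℝ)) (by simp)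
      have h := (hx u hu _ _ (sm φ j hφ) (sm χ i hχ) (cs φ j cφ) (cs χ i cχ)).1
        (H u hu _ _ (sm φ j hφ) (sm χ i hχ) (cs φ j cφ) (cs χ i cχ))
      rw [← h]
      congr 1
      ext x
      refine ((Finset.sum_eq_single i ?_ ?_).trans
        ((Finset.sum_eq_single j ?_ ?_).trans ?_)).symm
      · intro b _ hb
        simp [Pi.single_apply, hb]
      · simp
      · intro b _ hb
        simp [Pi.single_apply, hb]
      · simp
      · simp
    obtain ⟨φ⟩ : Nonempty (ContDiffBump (0 : ℝ)) := inferInstance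
    have hφ : ContDiff ℝ (⊤ : ℕ∞) φ := φ.contDiff
    have cφ : HasCompactSupport φ := φ.hasCompactSupport
    have φ0 : φ 0 = 1 := φ.one_of_mem_closedBall (by simp [φ.rIn_pos.le])
    have hd : ∀ m : ℕ∞, ContDiff ℝ (⊤ : ℕ∞) (deriv φ) := fun _ =>
      (contDiff_infty_iff_deriv.1 hφ).2
    have hsym : ∀ i j v, g i j v = g j i v := by
      intro i j v
      have h := key (fun _ => v) contDiff_const (deriv φ) φ (hd 0) hφ cφ.deriv cφ i j
      simp only [deriv_const, mul_zero, Finset.sum_const_zero, zero_mul, zero_add, mul_assoc]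
        at h
      rw [integral_const_mul] at h
      rcases mul_eq_zero.1 h with h | h
      · linarith
      · exfalso
        have hne : ∃ x, deriv φ x ≠ 0 := by
          by_contra! hc
          have hconst := is_const_of_deriv_eq_zero (hφ.differentiable (by simp)) hc
          have : φ (φ.rOut + 1) = 0 := φ.zero_of_le_dist (by
            rw [Real.dist_eq, sub_zero]; exact le_trans (by linarith) (le_abs_self _))
          rw [hconst _ 0, φ0] at this
          exact one_ne_zero this
        obtain ⟨x, hx⟩ := hne
        have hpos := Continuous.integral_pos_of_hasCompactSupport_nonneg_nonzero
          (μ := volume) (f := fun x => deriv φ x * deriv φ x) (x := x)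
          ((hd 0).continuous.mul (hd 0).continuous) (cφ.deriv.mul_right)
          (fun y => mul_self_nonneg _) (mul_self_ne_zero.2 hx)
        exact hpos.ne' h
    refine ⟨hsym, fun i j k v => ?_⟩
    set u : ℝ → Fin n → ℝ := fun x => v + x • Pi.single k 1 with hu_def
    have hu : ContDiff ℝ (⊤ : ℕ∞) u := by
      simp only [hu_def]; fun_prop
    have hdu : ∀ l x, deriv (fun t => u t l) x = (Pi.single k 1 : Fin n → ℝ) l := by
      intro l x
      have : HasDerivAt (fun t : ℝ => v l + t * (Pi.single k 1 : Fin n → ℝ) l)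
          (1 * (Pi.single k 1 : Fin n → ℝ) l) x :=
        ((hasDerivAt_id x).mul_const _).const_add _
      simpa [hu_def] using this.deriv
    set f : ℝ → ℝ := fun x => Γup i j k (u x) + Γup j i k (u x)
            - fderiv ℝ (g i j) (u x) (Pi.single k 1) with hf
    have cu := hu.continuous
    have cf : Continuous f :=
      (((hΓ i j k).continuous.comp cu).add ((hΓ j i k).continuous.comp cu)).sub
        ((((hg i j).continuous_fderiv (by simp)).comp cu).clm_apply continuous_const)
    have hff : ∀ x, (∑ l, (Γup i j l (u x) + Γup j i l (u x)
            - fderiv ℝ (g i j) (u x) (Pi.single l 1)) * deriv (fun t => u t l) x) = f x := by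
      intro x
      rw [Finset.sum_eq_single k]
      · simp [hdu, hf]
      · intro b _ hb
        simp [hdu, hb]
      · simp
    have cfφ : Continuous fun x => f x * φ x := cf.mul hφ.continuous
    have hae : ∀ᵐ x ∂(volume : Measure ℝ), f x * φ x = 0 := by
      refine ae_eq_zero_of_integral_contDiff_smul_eq_zero cfφ.locallyIntegrable ?_
      intro χ hχ cχ
      have h := key u hu φ χ hφ hχ cφ cχ i j
      refine Eq.trans ?_ h
      congr 1
      ext x
      rw [hff, hsym j i, smul_eq_mul]
      ring
    have h0 := congrFun ((Continuous.ae_eq_iff_eq volume cfφ continuous_const).1 hae) 0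
    simp only [φ0, mul_one, hf, hu_def, zero_smul, add_zero] at h0
    linarith
  · rintro ⟨h1, h2⟩ u hu ψ₁ ψ₂ a b c d
    rw [hx u hu ψ₁ ψ₂ a b c d]
    have : ∀ i j v, g i j v - g j i v = 0 := fun i j v => sub_eq_zero.2 (h1 i j v)
    simp [h2, this]
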